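/- arXiv:2204.09458 — 6 statements merged into one kernel-verified Lean document; each statement's English description precedes it below -/
import Mathlib

section
/- Let G be a group with at least three elements. Then the conjugation quandle Conj(G) is not left circularly orderable: every map c : G³ → {-1,0,1} satisfying c(s*s₁, s*s₂, s*s₃) = c(s₁,s₂,s₃) for all s,s₁,s₂,s₃ (where g*h = h⁻¹gh) and satisfying axiom (2) of a circular ordering must be identically zero, so it fails axiom (1) since G contains three pairwise distinct elements. -/
/-- A circular ordering on a set `T`: a map `c : T³ → {-1,0,1}` vanishing exactly on
non-pairwise-distinct triples and satisfying the cocycle condition. -/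
def IsCircularOrdering {T : Type*} (c : T → T → T → ℤ) : Prop :=
  (∀ t₁ t₂ t₃, c t₁ t₂ t₃ = -1 ∨ c t₁ t₂ t₃ = 0 ∨ c t₁ t₂ t₃ = 1) ∧
  (∀ t₁ t₂ t₃, c t₁ t₂ t₃ = 0 ↔ ¬(t₁ ≠ t₂ ∧ t₂ ≠ t₃ ∧ t₁ ≠ t₃)) ∧
  (∀ t₁ t₂ t₃ t₄, c t₁ t₂ t₃ - c t₁ t₂ t₄ + c t₁ t₃ t₄ - c t₂ t₃ t₄ = 0)

/-- If `G` is a group with at least three elements, then the conjugation quandle `Conj(G)`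
(with operation `g * h = h⁻¹ g h`) is not left circularly orderable: there is no circular
ordering `c` on `G` with `c (s*s₁) (s*s₂) (s*s₃) = c s₁ s₂ s₃` for all `s, s₁, s₂, s₃`,
where `s * sᵢ = sᵢ⁻¹ s sᵢ`. -/
theorem conj_quandle_not_left_circularly_orderable
    {G : Type*} [Group G] (h3 : ∃ x y z : G, x ≠ y ∧ y ≠ z ∧ x ≠ z) :
    ¬ ∃ c : G → G → G → ℤ, IsCircularOrdering c ∧
        ∀ s s₁ s₂ s₃ : G,
          c (s₁⁻¹ * s * s₁) (s₂⁻¹ * s * s₂) (s₃⁻¹ * s * s₃) = c s₁ s₂ s₃ := by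
  rintro ⟨c, ⟨-, h0, -⟩, hinv⟩
  obtain ⟨x, y, z, h⟩ := h3
  have h1 := hinv 1 x y z
  have h2 : c 1 1 1 = 0 := (h0 1 1 1).2 (fun hh => hh.1 rfl)
  simp only [mul_one, inv_mul_cancel] at h1
  exact (h0 x y z).1 (h1.symm.trans h2) h
end

section
/- Let X = {1,2,3} be the quandle with operation given by the Cayley table with rows indexed by the first argument: 1*1=1, 1*2=1, 1*3=2, 2*1=2, 2*2=2, 2*3=1, 3*1=3, 3*2=3, 3*3=3. Then X is not right circularly orderable: there is no circular ordering c on X satisfying c(s₁*s, s₂*s, s₃*s) = c(s₁,s₂,s₃) for all s,s₁,s₂,s₃ ∈ X. -/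
/-- The three-element quandle `X = {1,2,3}` (encoded as `Fin 3` with `1 ↦ 0`, `2 ↦ 1`,
`3 ↦ 2`) with Cayley table `1*1=1, 1*2=1, 1*3=2, 2*1=2, 2*2=2, 2*3=1, 3*1=3, 3*2=3, 3*3=3`
is not right circularly orderable. -/
theorem three_element_quandle_not_right_circularly_orderable
    (op : Fin 3 → Fin 3 → Fin 3)
    (h11 : op 0 0 = 0) (h12 : op 0 1 = 0) (h13 : op 0 2 = 1)
    (h21 : op 1 0 = 1) (h22 : op 1 1 = 1) (h23 : op 1 2 = 0)
    (h31 : op 2 0 = 2) (h32 : op 2 1 = 2) (h33 : op 2 2 = 2) :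
    ¬ ∃ c : Fin 3 → Fin 3 → Fin 3 → ℤ, IsCircularOrdering c ∧
        ∀ s s₁ s₂ s₃ : Fin 3, c (op s₁ s) (op s₂ s) (op s₃ s) = c s₁ s₂ s₃ := by
  rintro ⟨c, ⟨-, hz, hc⟩, hop⟩
  have e := hop 2 0 1 2
  rw [h13, h23, h33] at e
  have k := hc 0 1 0 2
  have z1 : c 0 1 0 = 0 := (hz 0 1 0).2 (by decide)
  have z2 : c 0 0 2 = 0 := (hz 0 0 2).2 (by decide)
  have z : c 0 1 2 = 0 := by omega
  exact (hz 0 1 2).1 z (by decide)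
end

section
/- The dihedral quandle on ℤ/3ℤ, with operation x*y = 2y - x, admits no right-invariant circular ordering: there is no circular ordering c on ℤ/3ℤ satisfying c(s₁*s, s₂*s, s₃*s) = c(s₁,s₂,s₃) for all s,s₁,s₂,s₃ ∈ ℤ/3ℤ. -/
/-- The dihedral quandle on `ℤ/3ℤ`, with operation `x * y = 2y - x`, admits no
right-invariant circular ordering. -/
theorem dihedral_quandle_zmod3_not_right_circularly_orderable :
    ¬ ∃ c : ZMod 3 → ZMod 3 → ZMod 3 → ℤ, IsCircularOrdering c ∧
        ∀ s s₁ s₂ s₃ : ZMod 3,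
          c (2 * s - s₁) (2 * s - s₂) (2 * s - s₃) = c s₁ s₂ s₃ := by
  rintro ⟨c, ⟨-, hz, hc⟩, hinv⟩
  have h1 : c 0 2 1 = c 0 1 2 := hinv 0 0 1 2
  have h2 := hc 0 1 2 1
  have h3 : c 0 1 1 = 0 := (hz 0 1 1).2 (by decide)
  have h4 : c 1 2 1 = 0 := (hz 1 2 1).2 (by decide)
  have h5 : c 0 1 2 = 0 := by omega
  exact (hz 0 1 2).1 h5 (by decide)
end

section
/- The dihedral quandle on ℤ/3ℤ, with operation x*y = 2y - x, admits no left-invariant circular ordering: there is no circular ordering c on ℤ/3ℤ satisfying c(s*s₁, s*s₂, s*s₃) = c(s₁,s₂,s₃) for all s,s₁,s₂,s₃ ∈ ℤ/3ℤ. -/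
/-- The dihedral quandle on `ℤ/3ℤ`, with operation `x * y = 2y - x`, admits no
left-invariant circular ordering. -/
theorem dihedral_quandle_zmod3_not_left_circularly_orderable :
    ¬ ∃ c : ZMod 3 → ZMod 3 → ZMod 3 → ℤ, IsCircularOrdering c ∧
        ∀ s s₁ s₂ s₃ : ZMod 3,
          c (2 * s₁ - s) (2 * s₂ - s) (2 * s₃ - s) = c s₁ s₂ s₃ := by
  rintro ⟨c, ⟨_, h0, hc⟩, hi⟩
  have e1 : c 0 2 1 = c 0 1 2 := hi 0 0 1 2
  have e2 := hc 0 1 2 1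
  have e3 : c 0 1 1 = 0 := (h0 0 1 1).2 (by decide)
  have e4 : c 1 2 1 = 0 := (h0 1 2 1).2 (by decide)
  have e5 : c 0 1 2 = 0 := by omega
  exact (h0 0 1 2).1 e5 (by decide)
end

section
/- Let Q be a quandle. The set RCO(Q) of right circular orderings on Q, regarded as a subset of the space of all functions Q×Q×Q → {-1,0,1} equipped with the product (Tychonoff) topology where {-1,0,1} carries the discrete topology, is a closed subset; consequently RCO(Q) is a compact topological space. -/
/-- A quandle structure on a set `Q`: a binary operation `op` such that every element is
idempotent, every right translation is a bijection, and right self-distributivity holds. -/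
structure IsQuandle {Q : Type*} (op : Q → Q → Q) : Prop where
  idem : ∀ s, op s s = s
  rightTranslation_bijective : ∀ s, Function.Bijective fun t => op t s
  right_distrib : ∀ s₁ s₂ s₃, op (op s₁ s₂) s₃ = op (op s₁ s₃) (op s₂ s₃)

/-- The set `RCO(Q)` of right circular orderings on a quandle `(Q, op)`, as a subset of the
space of all functions `Q × Q × Q → {-1, 0, 1}`. -/
def RCO {Q : Type*} (op : Q → Q → Q) : Set (Q × Q × Q → ({-1, 0, 1} : Set ℤ)) :=
  {c | (∀ x y z : Q, ((c (x, y, z) : ℤ) = 0 ↔ ¬(x ≠ y ∧ y ≠ z ∧ x ≠ z))) ∧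
       (∀ x y z w : Q,
         (c (x, y, z) : ℤ) - (c (x, y, w) : ℤ) + (c (x, z, w) : ℤ) - (c (y, z, w) : ℤ) = 0) ∧
       (∀ s x y z : Q, c (op x s, op y s, op z s) = c (x, y, z))}

/-- For a quandle `Q`, the set `RCO(Q)` of right circular orderings is a closed subset of the
space of all functions `Q × Q × Q → {-1, 0, 1}` with the product (Tychonoff) topology, where
`{-1, 0, 1}` is discrete; consequently `RCO(Q)` is compact. -/
theorem rco_isClosed_and_isCompact {Q : Type*} (op : Q → Q → Q) (hQ : IsQuandle op) :
    IsClosed (RCO op) ∧ IsCompact (RCO op) := by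
  have hclosed : IsClosed (RCO op) := by
    have hcont : ∀ p : Q × Q × Q,
        Continuous fun c : Q × Q × Q → ({-1, 0, 1} : Set ℤ) => (c p : ℤ) :=
      fun p => continuous_subtype_val.comp (continuous_apply p)
    simp only [RCO, Set.ofPred_and, Set.ofPred_forall]
    refine IsClosed.inter ?_ (IsClosed.inter ?_ ?_)
    · refine isClosed_iInter fun x => isClosed_iInter fun y => isClosed_iInter fun z => ?_
      exact (isClosed_discrete {n : ℤ | n = 0 ↔ ¬(x ≠ y ∧ y ≠ z ∧ x ≠ z)}).preimage
        (hcont (x, y, z))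
    · refine isClosed_iInter fun x => isClosed_iInter fun y => isClosed_iInter fun z =>
        isClosed_iInter fun w => ?_
      exact isClosed_eq ((((hcont _).sub (hcont _)).add (hcont _)).sub (hcont _))
        continuous_const
    · refine isClosed_iInter fun s => isClosed_iInter fun x => isClosed_iInter fun y =>
        isClosed_iInter fun z => ?_
      exact isClosed_eq (continuous_apply _) (continuous_apply _)
  have : Finite ({-1, 0, 1} : Set ℤ) := Set.Finite.to_subtype (by simp)
  exact ⟨hclosed, hclosed.isCompact⟩
end

section
/- Let Q be a quandle. The map i : LO(Q) → LCO(Q) sending a left ordering ≺ to the induced circular ordering c_≺ (defined by c_≺(s₁,s₂,s₃) = 1 if s₁ ≺ s₂ ≺ s₃ or s₂ ≺ s₃ ≺ s₁ or s₃ ≺ s₁ ≺ s₂, c_≺(s₁,s₂,s₃) = -1 if s₁ ≺ s₃ ≺ s₂ or s₃ ≺ s₂ ≺ s₁ or s₂ ≺ s₁ ≺ s₃, and 0 otherwise) is a topological embedding, where LO(Q) carries the topology with subbasis {V_(a,b) : a ≠ b}, V_(a,b) = {≺ ∈ LO(Q) : a ≺ b}, and LCO(Q) carries the subspace topology from the product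 topology on functions Q×Q×Q → {-1,0,1} with {-1,0,1} discrete. -/
open scoped Classical

/-- The set `LO(Q)` of left orderings of a quandle `(Q, op)`: strict total orders `≺` on `Q`
such that `s ≺ t` implies `r*s ≺ r*t`. -/
def LO {Q : Type*} (op : Q → Q → Q) : Set (Q → Q → Prop) :=
  {prec | IsStrictTotalOrder Q prec ∧ ∀ r s t : Q, prec s t → prec (op r s) (op r t)}

/-- The set `LCO(Q)` of left circular orderings on a quandle `(Q, op)`, as a subset of the
space of all functions `Q × Q × Q → {-1, 0, 1}`. -/
def LCO {Q : Type*} (op : Q → Q → Q) : Set (Q × Q × Q → ({-1, 0, 1} : Set ℤ)) :=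
  {c | (∀ x y z : Q, ((c (x, y, z) : ℤ) = 0 ↔ ¬(x ≠ y ∧ y ≠ z ∧ x ≠ z))) ∧
       (∀ x y z w : Q,
         (c (x, y, z) : ℤ) - (c (x, y, w) : ℤ) + (c (x, z, w) : ℤ) - (c (y, z, w) : ℤ) = 0) ∧
       (∀ s x y z : Q, c (op s x, op s y, op s z) = c (x, y, z))}

/-- The topology on `LO(Q)` with subbasis `{V_(a,b) : a ≠ b}`, where
`V_(a,b) = {≺ ∈ LO(Q) : a ≺ b}`. -/
def loTopology {Q : Type*} (op : Q → Q → Q) : TopologicalSpace (LO op) :=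
  TopologicalSpace.generateFrom
    {U : Set (LO op) | ∃ a b : Q, a ≠ b ∧ U = {prec : LO op | prec.1 a b}}

/-- For a quandle `Q`, the map `i : LO(Q) → LCO(Q)` sending a left ordering `≺` to the
induced circular ordering `c_≺` is a topological embedding, where `LO(Q)` carries the
topology with subbasis `{V_(a,b) : a ≠ b}` and `LCO(Q)` carries the subspace topology from
the product topology on functions `Q × Q × Q → {-1, 0, 1}` with `{-1, 0, 1}` discrete. -/
theorem lo_embeds_in_lco {Q : Type*} (op : Q → Q → Q) (hQ : IsQuandle op)
    (i : LO op → LCO op)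
    (hi : ∀ (prec : LO op) (x y z : Q),
      (((i prec : Q × Q × Q → ({-1, 0, 1} : Set ℤ)) (x, y, z)) : ℤ) =
        if (prec.1 x y ∧ prec.1 y z) ∨ (prec.1 y z ∧ prec.1 z x) ∨ (prec.1 z x ∧ prec.1 x y)
          then 1
        else if (prec.1 x z ∧ prec.1 z y) ∨ (prec.1 z y ∧ prec.1 y x) ∨
            (prec.1 y x ∧ prec.1 x z)
          then -1
        else 0) :
    @Topology.IsEmbedding (LO op) (LCO op) (loTopology op) inferInstance i := by
  letI : TopologicalSpace (LO op) := loTopology op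
  change Topology.IsEmbedding i
  have htr : ∀ (p : LO op) (x y z : Q), p.1 x y → p.1 y z → p.1 x z := fun p x y z h1 h2 =>
    p.2.1.toIsStrictOrder.toIsTrans.trans x y z h1 h2
  have hirr : ∀ (p : LO op) (x : Q), ¬ p.1 x x := fun p x =>
    p.2.1.toIsStrictOrder.toIrrefl.irrefl x
  have htot : ∀ (p : LO op) (x y : Q), x ≠ y → p.1 x y ∨ p.1 y x := fun p x y hne => by
    by_contra h
    push Not at h
    exact hne (p.2.1.toTrichotomous.trichotomous x y h.1 h.2)
  -- the key point: a ≺ b is detected by one value of the circular ordering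
  have key : ∀ a b x : Q, a ≠ b → op x a = b → ∀ p : LO op,
      (p.1 a b ↔ (((i p : Q × Q × Q → ({-1, 0, 1} : Set ℤ)) (a, b, op x b)) : ℤ) = 1) := by
    intro a b x hab hx p
    rw [hi]
    constructor
    · intro h
      have h2 := p.2.2 x a b h
      rw [hx] at h2
      rw [if_pos (Or.inl ⟨h, h2⟩)]
    · intro h
      by_contra hn
      have hba : p.1 b a := (htot p a b hab).resolve_left hn
      have h2 := p.2.2 x b a hba
      rw [hx] at h2
      have h3 : ¬ p.1 b (op x b) := fun h3 => hirr p _ (htr p _ _ _ h3 h2)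
      rw [if_neg (by tauto)] at h
      split_ifs at h <;> omega
  have hopen : ∀ a b : Q, IsOpen {p : LO op | p.1 a b} := by
    intro a b
    by_cases hab : a = b
    · subst hab
      have : {p : LO op | p.1 a a} = ∅ := by
        ext p
        simpa using hirr p a
      rw [this]
      exact isOpen_empty
    · exact TopologicalSpace.isOpen_generateFrom_of_mem ⟨a, b, hab, rfl⟩
  have hclopen : ∀ a b : Q, IsClopen {p : LO op | p.1 a b} := by
    intro a b
    refine ⟨⟨?_⟩, hopen a b⟩
    by_cases hab : a = b
    · subst hab
      have : {p : LO op | p.1 a a}ᶜ = Set.univ := by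
        ext p
        simpa using hirr p a
      rw [this]
      exact isOpen_univ
    · have : {p : LO op | p.1 a b}ᶜ = {p : LO op | p.1 b a} := by
        ext p
        constructor
        · intro h
          exact (htot p a b hab).resolve_left h
        · intro h h'
          exact hirr p a (htr p _ _ _ h' h)
      rw [this]
      exact hopen b a
  have hite : ∀ (P : LO op → Prop) (_ : ∀ p, Decidable (P p)) (f g : LO op → ℤ), IsClopen {p | P p} → Continuous f →
      Continuous g → Continuous (fun p => if P p then f p else g p) := by
    intro P _ f g hP hf hg
    refine Continuous.if ?_ hf hg
    intro p hp
    rw [hP.frontier_eq] at hp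
    exact absurd hp (Set.notMem_empty p)
  have h3 : ∀ a b c d e f a' b' c' d' e' f' : Q, IsClopen {p : LO op |
      (p.1 a b ∧ p.1 c d) ∨ (p.1 e f ∧ p.1 a' b') ∨ (p.1 c' d' ∧ p.1 e' f')} :=
    fun a b c d e f a' b' c' d' e' f' =>
      ((hclopen a b).inter (hclopen c d)).union
        (((hclopen e f).inter (hclopen a' b')).union ((hclopen c' d').inter (hclopen e' f')))
  have hcont : Continuous i := by
    refine Continuous.subtype_mk (f := fun p => (i p).1) ?_ (fun p => (i p).2)
    refine continuous_pi ?_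
    rintro ⟨x, y, z⟩
    rw [Topology.IsEmbedding.subtypeVal.continuous_iff]
    have : (Subtype.val ∘ fun p : LO op => (i p).1 (x, y, z)) = _ := funext fun p => hi p x y z
    rw [this]
    exact hite _ _ _ _ (h3 ..) continuous_const
      (hite _ _ _ _ (h3 ..) continuous_const continuous_const)
  refine ⟨⟨le_antisymm hcont.le_induced ?_⟩, ?_⟩
  · refine le_generateFrom ?_
    rintro U ⟨a, b, hab, rfl⟩
    obtain ⟨x, hx⟩ := (hQ.rightTranslation_bijective a).2 b
    refine ⟨{c : LCO op | ((c.1 (a, b, op x b)) : ℤ) = 1}, ?_, ?_⟩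
    · have hc : Continuous fun c : LCO op => ((c.1 (a, b, op x b)) : ℤ) :=
        continuous_subtype_val.comp ((continuous_apply _).comp continuous_subtype_val)
      exact (isOpen_discrete ({1} : Set ℤ)).preimage hc
    · ext p
      exact (key a b x hab hx p).symm
  · intro p q hpq
    apply Subtype.ext
    funext a b
    apply propext
    by_cases hab : a = b
    · subst hab
      exact iff_of_false (hirr p a) (hirr q a)
    · obtain ⟨x, hx⟩ := (hQ.rightTranslation_bijective a).2 b
      rw [key a b x hab hx p, key a b x hab hx q, hpq]
end
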